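/- arXiv:2301.04171 — 2 statements merged into one kernel-verified Lean document; each statement's English description precedes it below -/
import Mathlib

section
/- Let ζ be an N×m complex matrix with orthonormal columns, i.e. ζ†ζ = I_m, write ζ₊ for its first k rows and ζ₋ for its remaining N−k rows, and let D be the N×N block-diagonal matrix with diagonal blocks ζ₊ζ₊† and ζ₋ζ₋†. Then the following are equivalent: (i) ζ₊ζ₋† = 0; (ii) D is idempotent (D·D = D); (iii) there exists a unitary N×N matrix U such that U·D·U† is the diagonal matrix whose first m diagonal entries equal 1 and whose remaining N−m diagonal entries equal 0. -/
open Matrix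

theorem aux_ext {ι : Type} [Fintype ι] [DecidableEq ι] (m : ℕ) (Z : Matrix ι (Fin m) ℂ)
    (hZ : Zᴴ * Z = 1) (f : Fin m → ι) (hf : Function.Injective f) :
    ∃ V : Matrix ι ι ℂ, Vᴴ * V = 1 ∧ V.submatrix id f = Z := by
  classical
  let col : Fin m → EuclideanSpace ℂ ι := fun a => WithLp.toLp 2 (fun i => Z i a)
  let v : ι → EuclideanSpace ℂ ι := Function.extend f col 0
  have hvf : ∀ a, v (f a) = col a := fun a => hf.extend_apply _ _ _
  have hcol : ∀ a b, inner ℂ (col a) (col b) = if a = b then (1 : ℂ) else 0 := by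
    intro a b
    have := congrFun (congrFun hZ a) b
    rw [Matrix.mul_apply, Matrix.one_apply] at this
    rw [← this, PiLp.inner_apply]
    refine Finset.sum_congr rfl fun i _ => ?_
    simp [col, mul_comm]
  have ho : Orthonormal ℂ ((Set.range f).domRestrict v) := by
    rw [orthonormal_iff_ite]
    rintro ⟨_, a, rfl⟩ ⟨_, b, rfl⟩
    change inner ℂ (v (f a)) (v (f b)) = _
    rw [hvf, hvf, hcol]
    refine if_congr ?_ rfl rfl
    exact ⟨fun h => by subst h; rfl, fun h => hf (congrArg Subtype.val h)⟩
  obtain ⟨b, hb⟩ := ho.exists_orthonormalBasis_extension_of_card_eq (by simp)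
  refine ⟨Matrix.of fun i j => b j i, ?_, ?_⟩
  · ext i j
    have := orthonormal_iff_ite.1 b.orthonormal i j
    rw [Matrix.mul_apply, Matrix.one_apply, ← this, PiLp.inner_apply]
    refine Finset.sum_congr rfl fun i _ => ?_
    simp [mul_comm]
  · ext i a
    simp [hb (f a) ⟨a, rfl⟩, hvf, col]

/-- Let `ζ` be an `(k+l) × m` complex matrix with orthonormal columns (`ζᴴ ζ = 1`), let
`ζ₊` be its first `k` rows and `ζ₋` its last `l` rows, and let
`D = fromBlocks (ζ₊ ζ₊ᴴ) 0 0 (ζ₋ ζ₋ᴴ)`.  Then the following are equivalent: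
(i) `ζ₊ ζ₋ᴴ = 0`; (ii) `D` is idempotent; (iii) there is a unitary `U` with `U D Uᴴ`
equal to the diagonal matrix whose first `m` diagonal entries are `1` and whose
remaining entries are `0`. -/
theorem stmt5 (k l m : ℕ)
    (ζ : Matrix (Fin (k + l)) (Fin m) ℂ) (hζ : ζᴴ * ζ = 1) :
    let ζp := ζ.submatrix (Fin.castAdd l) id
    let ζm := ζ.submatrix (Fin.natAdd k) id
    let D := Matrix.fromBlocks (ζp * ζpᴴ) 0 0 (ζm * ζmᴴ)
    (ζp * ζmᴴ = 0 ↔ D * D = D) ∧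
    (ζp * ζmᴴ = 0 ↔
      ∃ U ∈ Matrix.unitaryGroup (Fin k ⊕ Fin l) ℂ,
        U * D * Uᴴ = Matrix.diagonal
          (fun i : Fin k ⊕ Fin l => if ((finSumFinEquiv i : ℕ) < m) then (1 : ℂ) else 0)) := by
  intro ζp ζm D
  have hsum : ζpᴴ * ζp + ζmᴴ * ζm = 1 := by
    rw [← hζ]
    ext i j
    simp [Matrix.mul_apply, Fin.sum_univ_add, ζp, ζm]
  have h12 : ζp * ζmᴴ = 0 → D * D = D := by
    intro h
    have h' : ζm * ζpᴴ = 0 := by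
      have := congrArg Matrix.conjTranspose h
      simpa using this
    have e1 : ζp * ζpᴴ * (ζp * ζpᴴ) = ζp * ζpᴴ := by
      calc ζp * ζpᴴ * (ζp * ζpᴴ) = ζp * (ζpᴴ * ζp + ζmᴴ * ζm) * ζpᴴ - (ζp * ζmᴴ) * (ζm * ζpᴴ) := by
            simp only [Matrix.mul_add, Matrix.add_mul, Matrix.mul_assoc]; abel
        _ = _ := by rw [hsum, h]; simp
    have e2 : ζm * ζmᴴ * (ζm * ζmᴴ) = ζm * ζmᴴ := by
      calc ζm * ζmᴴ * (ζm * ζmᴴ) = ζm * (ζpᴴ * ζp + ζmᴴ * ζm) * ζmᴴ - (ζm * ζpᴴ) * (ζp * ζmᴴ) := by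
            simp only [Matrix.mul_add, Matrix.add_mul, Matrix.mul_assoc]; abel
        _ = _ := by rw [hsum, h]; simp
    simp only [D, Matrix.fromBlocks_multiply, e1, e2]
    simp
  have h21 : D * D = D → ζp * ζmᴴ = 0 := by
    intro h
    simp only [D, Matrix.fromBlocks_multiply, Matrix.fromBlocks_inj] at h
    have e1 : ζp * ζpᴴ * (ζp * ζpᴴ) = ζp * ζpᴴ := by simpa using h.1
    have e2 : (ζp * ζmᴴ) * (ζp * ζmᴴ)ᴴ = 0 := by
      calc (ζp * ζmᴴ) * (ζp * ζmᴴ)ᴴ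
          = ζp * (ζpᴴ * ζp + ζmᴴ * ζm) * ζpᴴ - ζp * ζpᴴ * (ζp * ζpᴴ) := by
            simp only [Matrix.mul_add, Matrix.add_mul, Matrix.mul_assoc,
              Matrix.conjTranspose_mul, Matrix.conjTranspose_conjTranspose]; abel
        _ = 0 := by rw [hsum, e1]; simp
    open scoped ComplexOrder in
    exact Matrix.self_mul_conjTranspose_eq_zero.1 e2
  refine ⟨⟨h12, h21⟩, ?_, ?_⟩
  · intro h
    have h' : ζm * ζpᴴ = 0 := by
      have := congrArg Matrix.conjTranspose h
      simpa using this
    have hm : m ≤ k + l := by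
      have h1 := Matrix.rank_mul_le_right ζᴴ ζ
      have h2 := Matrix.rank_le_card_height ζ
      rw [hζ, Matrix.rank_one] at h1
      simpa using h1.trans h2
    let Z := Matrix.fromRows ζp ζm
    have hZ : Zᴴ * Z = 1 := by
      rw [← hsum]
      simp [Z, Matrix.conjTranspose_fromRows_eq_fromCols_conjTranspose, Matrix.fromCols_mul_fromRows]
    have hD : D = Z * Zᴴ := by
      simp [Z, D, Matrix.conjTranspose_fromRows_eq_fromCols_conjTranspose,
        Matrix.fromRows_mul_fromCols, h, h']
    let f : Fin m → Fin k ⊕ Fin l := fun a => finSumFinEquiv.symm (Fin.castLE hm a)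
    have hf : Function.Injective f :=
      finSumFinEquiv.symm.injective.comp (Fin.castLE_injective hm)
    obtain ⟨V, hV, hVZ⟩ := aux_ext m Z hZ f hf
    have hE : Vᴴ * Z = (1 : Matrix (Fin k ⊕ Fin l) (Fin k ⊕ Fin l) ℂ).submatrix id f := by
      rw [← hVZ, ← hV]; rfl
    refine ⟨Vᴴ, ?_, ?_⟩
    · rw [Matrix.mem_unitaryGroup_iff, Matrix.star_eq_conjTranspose,
        Matrix.conjTranspose_conjTranspose, hV]
    · have : Vᴴ * D * Vᴴᴴ = (Vᴴ * Z) * (Vᴴ * Z)ᴴ := by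
        rw [hD]; simp only [Matrix.conjTranspose_mul, Matrix.mul_assoc]
      rw [this, hE]
      ext i j
      rw [Matrix.mul_apply, Matrix.diagonal_apply]
      simp only [Matrix.submatrix_apply, Matrix.conjTranspose_apply, Matrix.one_apply, id]
      by_cases hi : ((finSumFinEquiv i : Fin (k + l)) : ℕ) < m
      · have hfi : f ⟨_, hi⟩ = i := by
          simp only [f]
          rw [Equiv.symm_apply_eq]
          rfl
        rw [Finset.sum_eq_single ⟨_, hi⟩]
        · rw [hfi]
          by_cases hij : i = j
          · subst hij
            simp [hi]
          · simp [hij, Ne.symm hij]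
        · intro b _ hb
          rw [if_neg, zero_mul]
          intro hib
          exact hb (hf (by rw [hfi, hib]))
        · simp
      · rw [Finset.sum_eq_zero]
        · simp [hi]
        · intro a _
          rw [if_neg, zero_mul]
          rintro rfl
          apply hi
          simp [f]
  · rintro ⟨U, hU, h⟩
    apply h21
    have hU1 : Uᴴ * U = 1 := Matrix.mem_unitaryGroup_iff'.1 hU
    set P := Matrix.diagonal
          (fun i : Fin k ⊕ Fin l => if ((finSumFinEquiv i : ℕ) < m) then (1 : ℂ) else 0) with hP
    have hPP : P * P = P := by
      rw [hP, Matrix.diagonal_mul_diagonal]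
      congr 1
      ext i
      split_ifs <;> simp
    have hD : D = Uᴴ * P * U := by
      rw [← h]
      calc D = (Uᴴ * U) * D * (Uᴴ * U) := by rw [hU1]; simp
        _ = _ := by simp only [Matrix.mul_assoc]
    have hU2 : U * Uᴴ = 1 := Matrix.mem_unitaryGroup_iff.1 hU
    calc D * D = Uᴴ * (P * (U * Uᴴ) * P) * U := by rw [hD]; simp only [Matrix.mul_assoc]
      _ = D := by rw [hU2, Matrix.mul_one, hPP, hD]
end

section
/- Let ζ be an N×m complex matrix with orthonormal columns, i.e. ζ†ζ = I_m, write ζ₊ for its first k rows and ζ₋ for its remaining N−k rows, let D be the N×N block-diagonal Hermitian matrix with diagonal blocks ζ₊ζ₊† and ζ₋ζ₋†, and let λ₁, …, λ_N be the (real) eigenvalues of D. Then Σ_i max(λ_i − 1/2, 0) ≤ m/2, and equality holds if and only if ζ₊ζ₋† = 0. -/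
open Matrix

section
open scoped ComplexOrder

theorem aux_diag {n : Type*} [Fintype n] [DecidableEq n] {D : Matrix n n ℂ} (hD : D.IsHermitian) :
    Unitary.conjStarAlgAut ℂ _ (star hD.eigenvectorUnitary) (D - D * D) =
      diagonal (fun i => ((hD.eigenvalues i - hD.eigenvalues i * hD.eigenvalues i : ℝ) : ℂ)) := by
  rw [map_sub, map_mul, hD.conjStarAlgAut_star_eigenvectorUnitary, diagonal_mul_diagonal,
    diagonal_sub]
  congr 1
  funext i
  simp

theorem aux_nonneg {n p : Type*} [Fintype n] [DecidableEq n] [Fintype p] {D : Matrix n n ℂ}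
    (hD : D.IsHermitian) (M : Matrix n p ℂ) (h : D - D * D = M * Mᴴ) (i : n) :
    0 ≤ hD.eigenvalues i - hD.eigenvalues i * hD.eigenvalues i := by
  have h1 : (D - D * D).PosSemidef := h ▸ posSemidef_self_mul_conjTranspose M
  have h2 := aux_diag hD
  rw [Unitary.conjStarAlgAut_star_apply] at h2
  have h3 := h1.conjTranspose_mul_mul_same (hD.eigenvectorUnitary : Matrix n n ℂ)
  rw [← star_eq_conjTranspose, h2, posSemidef_diagonal_iff] at h3
  exact_mod_cast h3 i

theorem aux_zero {n : Type*} [Fintype n] [DecidableEq n] {D : Matrix n n ℂ}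
    (hD : D.IsHermitian) :
    (∀ i, hD.eigenvalues i - hD.eigenvalues i * hD.eigenvalues i = 0) ↔ D - D * D = 0 := by
  have h2 := aux_diag hD
  constructor
  · intro h
    apply EquivLike.injective (Unitary.conjStarAlgAut ℂ _ (star hD.eigenvectorUnitary))
    rw [map_zero]
    refine h2.trans ?_
    simp [h]
  · intro h i
    rw [h, map_zero] at h2
    have := congrFun (congrFun h2 i) i
    rw [diagonal_apply_eq, Matrix.zero_apply] at this
    exact_mod_cast this.symm

theorem aux_real (x : ℝ) (h : 0 ≤ x - x * x) :
    max (x - 1 / 2) 0 ≤ x / 2 ∧ (max (x - 1 / 2) 0 = x / 2 ↔ x - x * x = 0) := by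
  have h0 : 0 ≤ x := by nlinarith
  have h1 : x ≤ 1 := by nlinarith
  refine ⟨max_le (by linarith) (by linarith), ?_, ?_⟩
  · intro h
    rcases max_choice (x - 1 / 2) 0 with hm | hm <;> rw [hm] at h
    · have : x = 1 := by linarith
      simp [this]
    · have : x = 0 := by linarith
      simp [this]
  · intro h
    have : x * (1 - x) = 0 := by linarith
    rcases mul_eq_zero.1 this with h | h
    · subst h; norm_num
    · have : x = 1 := by linarith
      subst this; norm_num

theorem aux_main {k l m : ℕ} (A : Matrix (Fin k) (Fin m) ℂ) (B : Matrix (Fin l) (Fin m) ℂ)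
    (h : Aᴴ * A + Bᴴ * B = 1) (hD : (Matrix.fromBlocks (A * Aᴴ) 0 0 (B * Bᴴ)).IsHermitian) :
    (∑ i, max (hD.eigenvalues i - 1 / 2) 0 ≤ (m : ℝ) / 2) ∧
    ((∑ i, max (hD.eigenvalues i - 1 / 2) 0 = (m : ℝ) / 2) ↔ A * Bᴴ = 0) := by
  have hA : A * Aᴴ - A * Aᴴ * (A * Aᴴ) = A * Bᴴ * (A * Bᴴ)ᴴ := by
    have : A * (Aᴴ * A + Bᴴ * B) * Aᴴ = A * Aᴴ := by rw [h, Matrix.mul_one]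
    rw [sub_eq_iff_eq_add]
    refine this.symm.trans ?_
    simp only [Matrix.mul_add, Matrix.add_mul, Matrix.mul_assoc, conjTranspose_mul,
      conjTranspose_conjTranspose]
    rw [add_comm]
  have hB : B * Bᴴ - B * Bᴴ * (B * Bᴴ) = (A * Bᴴ)ᴴ * (A * Bᴴ) := by
    have : B * (Aᴴ * A + Bᴴ * B) * Bᴴ = B * Bᴴ := by rw [h, Matrix.mul_one]
    rw [sub_eq_iff_eq_add]
    refine this.symm.trans ?_
    simp only [Matrix.mul_add, Matrix.add_mul, Matrix.mul_assoc, conjTranspose_mul,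
      conjTranspose_conjTranspose]
  have hM : Matrix.fromBlocks (A * Aᴴ) 0 0 (B * Bᴴ) -
      Matrix.fromBlocks (A * Aᴴ) 0 0 (B * Bᴴ) * Matrix.fromBlocks (A * Aᴴ) 0 0 (B * Bᴴ) =
      Matrix.fromBlocks (A * Bᴴ * (A * Bᴴ)ᴴ) 0 0 ((A * Bᴴ)ᴴ * (A * Bᴴ)) := by
    rw [← hA, ← hB, fromBlocks_multiply, sub_eq_add_neg, fromBlocks_neg, fromBlocks_add]
    simp [sub_eq_add_neg]
  have hnn := aux_nonneg hD (Matrix.fromBlocks (A * Bᴴ) 0 0 (A * Bᴴ)ᴴ) (by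
    rw [hM, fromBlocks_conjTranspose, fromBlocks_multiply]
    simp)
  have hz := aux_zero hD
  have htr : ∑ i, hD.eigenvalues i / 2 = (m : ℝ) / 2 := by
    rw [← Finset.sum_div]
    congr 1
    have h1 := hD.trace_eq_sum_eigenvalues
    have ht : (Matrix.fromBlocks (A * Aᴴ) 0 0 (B * Bᴴ)).trace = (A * Aᴴ).trace + (B * Bᴴ).trace := by
      simp [Matrix.trace]
    rw [ht, trace_mul_comm A, trace_mul_comm B, ← trace_add, h, trace_one,
      Fintype.card_fin] at h1
    have h2 := congrArg Complex.re h1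
    simpa using h2.symm
  have hle : ∀ i ∈ Finset.univ, max (hD.eigenvalues i - 1 / 2) 0 ≤ hD.eigenvalues i / 2 :=
    fun i _ => (aux_real _ (hnn i)).1
  rw [← htr]
  refine ⟨Finset.sum_le_sum hle, ?_⟩
  rw [Finset.sum_eq_sum_iff_of_le hle]
  have e1 : (∀ i ∈ Finset.univ, max (hD.eigenvalues i - 1 / 2) 0 = hD.eigenvalues i / 2) ↔
      ∀ i, hD.eigenvalues i - hD.eigenvalues i * hD.eigenvalues i = 0 :=
    ⟨fun h i => (aux_real _ (hnn i)).2.1 (h i (Finset.mem_univ i)),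
      fun h i _ => (aux_real _ (hnn i)).2.2 (h i)⟩
  rw [e1, hz, hM]
  constructor
  · intro h
    have := congrArg toBlocks₁₁ h
    rw [toBlocks_fromBlocks₁₁] at this
    exact self_mul_conjTranspose_eq_zero.1 this
  · intro h
    rw [h]
    simp

end

/-- Let `ζ` be an `(k+l) × m` complex matrix with orthonormal columns (`ζᴴ ζ = 1`), let
`ζ₊` be its first `k` rows and `ζ₋` its last `l` rows, and let `D` be the Hermitian
block-diagonal matrix with blocks `ζ₊ ζ₊ᴴ` and `ζ₋ ζ₋ᴴ`, with eigenvalues `λ i`.  Then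
`∑ i, max (λ i - 1/2) 0 ≤ m / 2`, with equality if and only if `ζ₊ ζ₋ᴴ = 0`. -/
theorem stmt8 (k l m : ℕ)
    (ζ : Matrix (Fin (k + l)) (Fin m) ℂ) (hζ : ζᴴ * ζ = 1)
    (hD : (Matrix.fromBlocks
        ((ζ.submatrix (Fin.castAdd l) id) * (ζ.submatrix (Fin.castAdd l) id)ᴴ) 0 0
        ((ζ.submatrix (Fin.natAdd k) id) * (ζ.submatrix (Fin.natAdd k) id)ᴴ)).IsHermitian) :
    (∑ i, max (hD.eigenvalues i - 1 / 2) 0 ≤ (m : ℝ) / 2) ∧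
    ((∑ i, max (hD.eigenvalues i - 1 / 2) 0 = (m : ℝ) / 2) ↔
      (ζ.submatrix (Fin.castAdd l) id) * (ζ.submatrix (Fin.natAdd k) id)ᴴ = 0) := by
  refine aux_main _ _ ?_ hD
  rw [← hζ]
  ext i j
  simp [Matrix.mul_apply, Fin.sum_univ_add]
end
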